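/- For every λ ∈ ℂ \ {0}, α ∈ ℂ and every finitely supported sequence (h^{(i)})_{i≥0} of complex numbers, the linear operators L_m, W_m (m ∈ ℤ) on ℂ[s,t] defining Φ(λ,α,h) for b = −1 satisfy L_m∘L_n − L_n∘L_m = (n−m)L_{m+n}, L_m∘W_n − W_n∘L_m = (n−m)W_{m+n}, and W_m∘W_n − W_n∘W_m = 0 for all m, n ∈ ℤ; hence Φ(λ,α,h) is a module over the Lie algebra W(0,−1). -/

import Mathlib

open MvPolynomial

noncomputable section

/-- The polynomial ring `ℂ[s,t]`, realized as `MvPolynomial (Fin 2) ℂ`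
with `s = X 0` and `t = X 1`. -/
abbrev R2 : Type := MvPolynomial (Fin 2) ℂ

/-- The substitution `f(s,t) ↦ f(s-m,t)`, as a `ℂ`-linear map on `ℂ[s,t]`. -/
def shiftS (m : ℤ) : R2 →ₗ[ℂ] R2 :=
  (aeval (fun i : Fin 2 => if i = 0 then (X 0 - C (m : ℂ) : R2) else (X 1 : R2))).toLinearMap

/-- Multiplication by a fixed polynomial, as a `ℂ`-linear map. -/
def mulBy (p : R2) : R2 →ₗ[ℂ] R2 := LinearMap.mulLeft ℂ p

/-- The partial derivative `∂/∂t`, as a `ℂ`-linear map. -/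
def dT : R2 →ₗ[ℂ] R2 := (pderiv (1 : Fin 2)).toLinearMap

/-- Kronecker delta on `ℂ`. -/
def dlt (x y : ℂ) : ℂ := if x = y then 1 else 0

/-- `q_{n,k;α}(t) = n t^k − δ_{b,−1} n(n−1)α Σ_{j=0}^{k−1} α^{k−1−j} t^j
− δ_{b,1} n α Σ_{j=0}^{k−1} α^{k−1−j} t^j`. -/
def qpoly (b α : ℂ) (n : ℤ) (k : ℕ) : R2 :=
  (n : ℂ) • ((X 1 : R2) ^ k)
    - (dlt b (-1) * (n : ℂ) * ((n : ℂ) - 1) * α) •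
        ∑ j ∈ Finset.range k, (C (α ^ (k - 1 - j)) * (X 1 : R2) ^ j)
    - (dlt b 1 * (n : ℂ) * α) •
        ∑ j ∈ Finset.range k, (C (α ^ (k - 1 - j)) * (X 1 : R2) ^ j)

/-- `h_n(t) = Σ_i h^{(i)} q_{n,i;α}(t)` for a finitely supported sequence `h`. -/
def hpol (b α : ℂ) (h : ℕ →₀ ℂ) (n : ℤ) : R2 := h.sum fun i c => c • qpoly b α n i

/-- The polynomial `t − δ_{b,−1} mα − δ_{b,1}(1−δ_{m,0})α`. -/
def wcoef (b α : ℂ) (m : ℤ) : R2 :=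
  X 1 - C (dlt b (-1) * (m : ℂ) * α + dlt b 1 * (if m = 0 then 0 else 1) * α)

/-- The operator `W_m` of the module `Φ(λ,α,h)`:
`W_m · f(s,t) = λ^m (t − δ_{b,−1} mα − δ_{b,1}(1−δ_{m,0})α) f(s−m,t)`. -/
def PhiW (b lam α : ℂ) (m : ℤ) : R2 →ₗ[ℂ] R2 :=
  mulBy (C (lam ^ m) * wcoef b α m) ∘ₗ shiftS m

/-- The operator `L_m` of the module `Φ(λ,α,h)`:
`L_m · f(s,t) = λ^m (s + h_m(t)) f(s−m,t)
 + b m λ^m (t − δ_{b,−1} mα − δ_{b,1}(1−δ_{m,0})α) (∂f/∂t)(s−m,t)`. -/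
def PhiL (b lam α : ℂ) (h : ℕ →₀ ℂ) (m : ℤ) : R2 →ₗ[ℂ] R2 :=
  mulBy (C (lam ^ m) * (X 0 + hpol b α h m)) ∘ₗ shiftS m
    + (b * (m : ℂ) * lam ^ m) • (mulBy (wcoef b α m) ∘ₗ (shiftS m ∘ₗ dT))

/-- `r_m(t) = Σ_i r^{(i)} m t^i` for a finitely supported sequence `r`. -/
def rpol (r : ℕ →₀ ℂ) (m : ℤ) : R2 := r.sum fun i c => (c * (m : ℂ)) • ((X 1 : R2) ^ i)

/-- The operator `L_m` of the module `Θ(λ,r)`: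
`L_m · f(s,t) = λ^m (s + r_m(t)) f(s−m,t)`. -/
def ThetaL (lam : ℂ) (r : ℕ →₀ ℂ) (m : ℤ) : R2 →ₗ[ℂ] R2 :=
  mulBy (C (lam ^ m) * (X 0 + rpol r m)) ∘ₗ shiftS m

/-- The operator `W_m` of the module `Θ(λ,r)`: `W_m · f(s,t) = δ_{m,0} t f(s,t)`. -/
def ThetaW (m : ℤ) : R2 →ₗ[ℂ] R2 := if m = 0 then mulBy (X 1) else 0

lemma shiftS_mul (m : ℤ) (f g : R2) : shiftS m (f * g) = shiftS m f * shiftS m g := by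
  simp [shiftS]

lemma shiftS_C (m : ℤ) (c : ℂ) : shiftS m (C c) = C c := by
  simp [shiftS, algebraMap_eq]

lemma shiftS_X_zero (m : ℤ) : shiftS m (X 0) = X 0 - C (m : ℂ) := by
  simp [shiftS]

lemma shiftS_X_one (m : ℤ) : shiftS m (X 1) = X 1 := by
  simp [shiftS]

lemma shiftS_shiftS (m n : ℤ) (f : R2) : shiftS m (shiftS n f) = shiftS (m + n) f := by
  induction f using MvPolynomial.induction_on with
  | C a => simp only [shiftS_C]
  | add p q hp hq => simp only [map_add, hp, hq]
  | mul_X p i hp =>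
    simp only [shiftS_mul, hp]
    refine congrArg _ ?_
    fin_cases i
    · simp only [Fin.zero_eta, shiftS_X_zero, map_sub, shiftS_C, Int.cast_add, C_add]
      ring
    · simp only [Fin.mk_one, shiftS_X_one]

lemma dT_mul (f g : R2) : dT (f * g) = dT f * g + f * dT g := by
  have h := (pderiv (R := ℂ) (1 : Fin 2)).leibniz f g
  rw [smul_eq_mul, smul_eq_mul] at h
  exact h.trans (by rw [add_comm, mul_comm g]; rfl)

lemma dT_C (c : ℂ) : dT (C c) = 0 := by
  simp [dT]

lemma dT_X_zero : dT (X 0) = 0 := by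
  simp [dT, pderiv_X]

lemma dT_X_one : dT (X 1) = 1 := by
  simp [dT]

lemma dT_shiftS (m : ℤ) (f : R2) : dT (shiftS m f) = shiftS m (dT f) := by
  induction f using MvPolynomial.induction_on with
  | C a => simp only [shiftS_C, dT_C, map_zero]
  | add p q hp hq => simp only [map_add, hp, hq]
  | mul_X p i hp =>
    simp only [shiftS_mul, dT_mul, map_add, hp]
    congr 2
    fin_cases i
    · simp only [Fin.zero_eta, shiftS_X_zero, map_sub, dT_X_zero, dT_C, map_zero, sub_zero]
    · simp only [Fin.mk_one, shiftS_X_one, dT_X_one]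
      exact (shiftS_C m 1).symm

lemma shiftS_X_one_pow (m : ℤ) (k : ℕ) : shiftS m (X 1 ^ k) = X 1 ^ k := by
  simp [shiftS]

lemma wcoef_neg_one (α : ℂ) (m : ℤ) : wcoef (-1) α m = X 1 - C (m : ℂ) * C α := by
  have h : dlt (-1) 1 = 0 := by norm_num [dlt]
  rw [wcoef, h]
  simp [dlt]

/-- For `b = -1` every `h_n` is a combination of two polynomials `P`, `Q` in `t` alone, with
`P = (t - α) Q + const`. -/
lemma exists_hpol_neg_one_eq (α : ℂ) (h : ℕ →₀ ℂ) :
    ∃ P Q : R2, (∀ m, shiftS m P = P) ∧ (∀ m, shiftS m Q = Q) ∧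
      dT P = Q + (X 1 - C α) * dT Q ∧
      ∀ n : ℤ, hpol (-1) α h n
        = C (n : ℂ) * P - C (n : ℂ) * (C (n : ℂ) - 1) * C α * Q := by
  induction h using Finsupp.induction_linear with
  | zero => exact ⟨0, 0, by simp, by simp, by simp, by simp [hpol]⟩
  | add f g hf hg =>
    obtain ⟨P, Q, hP, hQ, hd, hn⟩ := hf
    obtain ⟨P', Q', hP', hQ', hd', hn'⟩ := hg
    refine ⟨P + P', Q + Q', fun m => by rw [map_add, hP, hP'],
      fun m => by rw [map_add, hQ, hQ'], ?_, fun n => ?_⟩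
    · rw [map_add, map_add, hd, hd']
      ring
    · have hadd : hpol (-1) α (f + g) n = hpol (-1) α f n + hpol (-1) α g n :=
        Finsupp.sum_add_index' (fun i => zero_smul _ _) fun i c d => add_smul _ _ _
      rw [hadd, hn, hn']
      ring
  | single k c =>
    set S : R2 := ∑ j ∈ Finset.range k, (C (α ^ (k - 1 - j)) * (X 1 : R2) ^ j) with hS
    have hgeom : (X 1 : R2) ^ k = (X 1 - C α) * S + C (α ^ k) := by
      have := geom_sum₂_mul (X 1 : R2) (C α) k
      rw [C_pow, ← sub_eq_iff_eq_add, ← this, hS, mul_comm]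
      simp only [C_pow, mul_comm]
    refine ⟨C c * X 1 ^ k, C c * S, fun m => ?_, fun m => ?_, ?_, fun n => ?_⟩
    · rw [shiftS_mul, shiftS_C, shiftS_X_one_pow]
    · rw [shiftS_mul, shiftS_C, hS, map_sum]
      simp only [shiftS_mul, shiftS_C, shiftS_X_one_pow]
    · rw [hgeom]
      simp only [dT_mul, map_add, map_sub, dT_C, dT_X_one]
      ring
    · have hq : qpoly (-1) α n k
          = C (n : ℂ) * X 1 ^ k - C (n : ℂ) * (C (n : ℂ) - 1) * C α * S := by
        have h1 : dlt (-1) 1 = 0 := by norm_num [dlt]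
        have h2 : dlt (-1) (-1) = 1 := if_pos rfl
        simp only [qpoly, h1, h2, ← hS, smul_eq_C_mul, C_mul, C_sub, C_0, C_1]
        ring
      have hs : hpol (-1) α (Finsupp.single k c) n = c • qpoly (-1) α n k :=
        Finsupp.sum_single_index (zero_smul _ _)
      rw [hs, hq, smul_eq_C_mul]
      ring

lemma PhiW_neg_one_apply (lam α : ℂ) (m : ℤ) (f : R2) :
    PhiW (-1) lam α m f = C (lam ^ m) * (X 1 - C (m : ℂ) * C α) * shiftS m f := by
  simp only [PhiW, mulBy, wcoef_neg_one, LinearMap.comp_apply, LinearMap.mulLeft_apply]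

lemma PhiL_neg_one_apply (lam α : ℂ) (h : ℕ →₀ ℂ) (m : ℤ) (f : R2) :
    PhiL (-1) lam α h m f = C (lam ^ m) * ((X 0 + hpol (-1) α h m) * shiftS m f
      - C (m : ℂ) * (X 1 - C (m : ℂ) * C α) * shiftS m (dT f)) := by
  simp only [PhiL, mulBy, wcoef_neg_one, LinearMap.add_apply, LinearMap.comp_apply,
    LinearMap.smul_apply, LinearMap.mulLeft_apply, smul_eq_C_mul, C_mul, C_neg, C_1]
  ring

/-- the operators defining `Φ(λ,α,h)` for `b = −1` satisfy the defining
relations of the Lie algebra `W(0,−1)`, so `Φ(λ,α,h)` is a `W(0,−1)`-module. -/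
theorem stmt1 (lam : ℂ) (hlam : lam ≠ 0) (α : ℂ) (h : ℕ →₀ ℂ) :
    (∀ m n : ℤ,
      PhiL (-1) lam α h m ∘ₗ PhiL (-1) lam α h n - PhiL (-1) lam α h n ∘ₗ PhiL (-1) lam α h m
        = ((n : ℂ) - (m : ℂ)) • PhiL (-1) lam α h (m + n)) ∧
    (∀ m n : ℤ,
      PhiL (-1) lam α h m ∘ₗ PhiW (-1) lam α n - PhiW (-1) lam α n ∘ₗ PhiL (-1) lam α h m
        = ((n : ℂ) - (m : ℂ)) • PhiW (-1) lam α (m + n)) ∧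
    (∀ m n : ℤ,
      PhiW (-1) lam α m ∘ₗ PhiW (-1) lam α n - PhiW (-1) lam α n ∘ₗ PhiW (-1) lam α m = 0) := by
  obtain ⟨P, Q, hP, hQ, hd, hn⟩ := exists_hpol_neg_one_eq α h
  have hdQ (k : ℤ) : shiftS k (dT Q) = dT Q := by rw [← dT_shiftS, hQ]
  have hd1 : dT (1 : R2) = 0 := dT_C 1
  have hs1 (k : ℤ) : shiftS k (1 : R2) = 1 := shiftS_C k 1
  refine ⟨fun m n => ?_, fun m n => ?_, fun m n => ?_⟩ <;> refine LinearMap.ext fun f => ?_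
  · simp only [LinearMap.sub_apply, LinearMap.comp_apply, LinearMap.smul_apply,
      PhiL_neg_one_apply, hn, shiftS_mul, shiftS_C, shiftS_X_zero, shiftS_X_one,
      shiftS_shiftS, map_add, map_sub, dT_mul, dT_C, dT_X_zero, dT_X_one, hs1, hd1,
      map_zero, dT_shiftS, hP, hQ, hdQ, hd, smul_eq_C_mul, zpow_add₀ hlam, C_mul, Int.cast_add,
      add_comm n m]
    ring
  · simp only [LinearMap.sub_apply, LinearMap.comp_apply, LinearMap.smul_apply,
      PhiL_neg_one_apply, PhiW_neg_one_apply, hn, shiftS_mul, shiftS_C, shiftS_X_zero,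
      shiftS_X_one, shiftS_shiftS, map_add, map_sub, dT_mul, dT_C, dT_X_one, hs1, map_zero,
      dT_shiftS, hP, hQ, smul_eq_C_mul, zpow_add₀ hlam, C_mul, Int.cast_add,
      add_comm n m]
    ring
  · simp only [LinearMap.sub_apply, LinearMap.comp_apply, LinearMap.zero_apply,
      PhiW_neg_one_apply, shiftS_mul, shiftS_C, shiftS_X_one, shiftS_shiftS, map_sub,
      add_comm n m]
    ring
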